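/- Fix d ≥ 1, η > 0, δ ≥ 1, C_G, A > 0, q ∈ ℝ, constants C_Λ ≥ 1 and λ ≥ 1, and for each integer m ≥ 3 and each coordinate interval a choice of m+1 distinct nodes whose univariate Lagrange interpolation operator satisfies the sup-norm stability bound with constant Λ_m ≥ 1, where Λ_m ≤ C_Λ (m+1)^λ. Set ρ̃ = min{Aη/(Aη+1), Aη/2}^{1/e²}. Then there exists a constant C_in > 0 (depending only on d, η, δ, C_G, A, q, C_Λ, λ) such that for every pair of η-admissible axis-parallel boxes Q_t, Q_s ⊂ ℝ^d with dist_2(Q_t, Q_s) > 0, every function g that is G^δ(C_G, A)-asymptotically smooth with exponent q on Q_t × Q_s, and every integer m ≥ 3, the tensor-product interpolant g̃ = 𝓘_m^{Q_t × Q_s}[g] satisfies sup_{(x,y) ∈ Q_t × Q_s} |g(x,y) − g̃(x,y)| ≤ C_in · dist_2(Q_t, Q_s)^{−(2q+d)} · ρ̃^{m^{1/δ}}. -/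

import Mathlib

/-- The axis-parallel box `∏_i [a i, b i] ⊆ ℝ^d`. -/
def box {d : ℕ} (a b : Fin d → ℝ) : Set (Fin d → ℝ) :=
  {y | ∀ i, y i ∈ Set.Icc (a i) (b i)}

/-- The `ℓ^∞`-diameter of the box `∏_i [a i, b i]`, i.e. `max_i (b i - a i)`. -/
noncomputable def diamInf {d : ℕ} (a b : Fin d → ℝ) : ℝ := ⨆ i, (b i - a i)

/-- The Euclidean distance between two points of `ℝ^d`. -/
noncomputable def euclDist {d : ℕ} (x y : Fin d → ℝ) : ℝ :=
  Real.sqrt (∑ i, (x i - y i) ^ 2)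

/-- The Euclidean distance `dist_2(S,T)` between two subsets of `ℝ^d`. -/
noncomputable def setDist2 {d : ℕ} (S T : Set (Fin d → ℝ)) : ℝ :=
  sInf {r | ∃ x ∈ S, ∃ y ∈ T, r = euclDist x y}

/-- The partial derivative of `g(x,y)` in the `i`-th coordinate of `x`. -/
noncomputable def pderivX {d : ℕ} (i : Fin d)
    (g : (Fin d → ℝ) → (Fin d → ℝ) → ℝ) : (Fin d → ℝ) → (Fin d → ℝ) → ℝ :=
  fun x y => deriv (fun t => g (Function.update x i t) y) (x i)

/-- The partial derivative of `g(x,y)` in the `i`-th coordinate of `y`. -/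
noncomputable def pderivY {d : ℕ} (i : Fin d)
    (g : (Fin d → ℝ) → (Fin d → ℝ) → ℝ) : (Fin d → ℝ) → (Fin d → ℝ) → ℝ :=
  fun x y => deriv (fun t => g x (Function.update y i t)) (y i)

/-- The mixed partial derivative `∂_x^α ∂_y^β g` for multi-indices
`α, β ∈ ℕ^d`. -/
noncomputable def mderivXY {d : ℕ} (α β : Fin d → ℕ) :
    ((Fin d → ℝ) → (Fin d → ℝ) → ℝ) → ((Fin d → ℝ) → (Fin d → ℝ) → ℝ) :=
  ((List.ofFn fun i : Fin d => (pderivX i)^[α i]) ++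
    (List.ofFn fun i : Fin d => (pderivY i)^[β i])).foldr (· ∘ ·) id

/-- `g` is `G^δ(C_G, A)`-asymptotically smooth with exponent `q` on
`D_x × D_y`. -/
def GevreyAsympSmooth {d : ℕ} (δ CG A q : ℝ) (Dx Dy : Set (Fin d → ℝ))
    (g : (Fin d → ℝ) → (Fin d → ℝ) → ℝ) : Prop :=
  (∃ U : Set ((Fin d → ℝ) × (Fin d → ℝ)), IsOpen U ∧
      {p | p.1 ∈ Dx ∧ p.2 ∈ Dy ∧ p.1 ≠ p.2} ⊆ U ∧
      ContDiffOn ℝ (⊤ : ℕ∞) (fun p => g p.1 p.2) U) ∧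
    ∀ α β : Fin d → ℕ, ∀ x ∈ Dx, ∀ y ∈ Dy, x ≠ y →
      |mderivXY α β g x y| ≤
        CG * A ^ (∑ i, α i + ∑ i, β i) *
          (((∏ i, (α i).factorial) * ∏ i, (β i).factorial : ℕ) : ℝ) ^ δ *
          euclDist x y ^
            (-(2 * q) - d - (∑ i, α i : ℕ) - (∑ i, β i : ℕ))

/-- Univariate Lagrange interpolation applied in the `i`-th `x`-coordinate. -/
noncomputable def coordInterpX {d m : ℕ} (xnodes : Fin d → Fin (m + 1) → ℝ)
    (i : Fin d) (g : (Fin d → ℝ) → (Fin d → ℝ) → ℝ) :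
    (Fin d → ℝ) → (Fin d → ℝ) → ℝ :=
  fun x y => (Lagrange.interpolate Finset.univ (xnodes i)
    (fun j => g (Function.update x i (xnodes i j)) y)).eval (x i)

/-- Univariate Lagrange interpolation applied in the `i`-th `y`-coordinate. -/
noncomputable def coordInterpY {d m : ℕ} (ynodes : Fin d → Fin (m + 1) → ℝ)
    (i : Fin d) (g : (Fin d → ℝ) → (Fin d → ℝ) → ℝ) :
    (Fin d → ℝ) → (Fin d → ℝ) → ℝ :=
  fun x y => (Lagrange.interpolate Finset.univ (ynodes i)
    (fun j => g x (Function.update y i (ynodes i j)))).eval (y i)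

/-- The tensor-product interpolation operator `𝓘_m^{Q_t × Q_s}` in all `2d`
variables. -/
noncomputable def tensorInterpXY {d m : ℕ}
    (xnodes ynodes : Fin d → Fin (m + 1) → ℝ) :
    ((Fin d → ℝ) → (Fin d → ℝ) → ℝ) → ((Fin d → ℝ) → (Fin d → ℝ) → ℝ) :=
  ((List.ofFn fun i : Fin d => coordInterpX xnodes i) ++
    (List.ofFn fun i : Fin d => coordInterpY ynodes i)).foldr (· ∘ ·) id

section Jackson

open Finset Real

/-- Sums of `cos (n t)` over equispaced points vanish for non-aliasing frequencies. -/
theorem sum_cos_equispaced (N : ℕ) (n : ℤ) (hn : |n| < N) (θ : ℝ) :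
    ∑ j ∈ range N, cos (n * (θ + 2 * π * j / N)) = if n = 0 then (N : ℝ) else 0 := by
  split_ifs with h0
  · simp [h0]
  have hNpos : (0 : ℝ) < N := by
    have : (0 : ℤ) < N := lt_of_le_of_lt (abs_nonneg n) hn
    exact_mod_cast this
  have hs : sin (n * π / N) ≠ 0 := by
    intro h
    rw [sin_eq_zero_iff] at h
    obtain ⟨k, hk⟩ := h
    have hk' : (k : ℝ) * N = n := by
      field_simp at hk
      exact hk
    have hk2 : k * N = n := by exact_mod_cast hk'
    have hk0 : k ≠ 0 := by
      rintro rfl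
      simp at hk2
      exact h0 hk2.symm
    have : (N : ℤ) ≤ |n| := by
      rw [← hk2, abs_mul, Nat.abs_cast]
      nlinarith [Int.one_le_abs hk0]
    omega
  have key : ∀ j : ℕ, 2 * sin (n * π / N) * cos (n * (θ + 2 * π * j / N)) =
      sin (n * θ + 2 * π * n * ((j + 1 : ℕ) : ℝ) / N - n * π / N) -
        sin (n * θ + 2 * π * n * (j : ℝ) / N - n * π / N) := by
    intro j
    rw [sin_sub_sin]
    push_cast
    congr 2 <;> [congr 1; skip] <;> field_simp <;> ring
  have hsum : 2 * sin (n * π / N) * ∑ j ∈ range N, cos (n * (θ + 2 * π * j / N)) = 0 := by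
    rw [mul_sum, sum_congr rfl fun j _ => key j,
      sum_range_sub (fun j : ℕ => sin (n * θ + 2 * π * n * (j : ℝ) / N - n * π / N))]
    have : n * θ + 2 * π * n * (N : ℝ) / N - n * π / N =
        (n * θ + 2 * π * n * ((0 : ℕ) : ℝ) / N - n * π / N) + n * (2 * π) := by
      field_simp
      push_cast
      ring
    rw [this, sin_add_int_mul_two_pi, sub_self]
  rcases mul_eq_zero.1 hsum with h | h
  · exact absurd h (by simpa using hs)
  · exact h

/-- The coefficients `sin ((k+1) π / (m+2))` of the Fejér–Korovkin kernel. -/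
noncomputable def korovkinCoeff (m k : ℕ) : ℝ := sin ((k + 1) * (π / (m + 2)))

/-- The (unnormalised) Fejér–Korovkin kernel. -/
noncomputable def korovkinKernel (m : ℕ) (t : ℝ) : ℝ :=
  ∑ k ∈ range (m + 1), ∑ l ∈ range (m + 1),
    korovkinCoeff m k * korovkinCoeff m l * cos (((k - l : ℤ) : ℝ) * t)

/-- The squared `ℓ²`-norm of the Fejér–Korovkin coefficients. -/
noncomputable def korovkinMass (m : ℕ) : ℝ := ∑ k ∈ range (m + 1), korovkinCoeff m k ^ 2

theorem korovkinKernel_nonneg (m : ℕ) (t : ℝ) : 0 ≤ korovkinKernel m t := by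
  have : korovkinKernel m t = (∑ k ∈ range (m + 1), korovkinCoeff m k * cos (k * t)) ^ 2 +
      (∑ k ∈ range (m + 1), korovkinCoeff m k * sin (k * t)) ^ 2 := by
    rw [sq, sq, sum_mul_sum, sum_mul_sum, ← sum_add_distrib]
    refine sum_congr rfl fun k _ => ?_
    rw [← sum_add_distrib]
    refine sum_congr rfl fun l _ => ?_
    push_cast
    rw [sub_mul, cos_sub]
    ring
  rw [this]
  positivity

theorem korovkinMass_pos (m : ℕ) : 0 < korovkinMass m := by
  have h0 : 0 < korovkinCoeff m 0 := by
    unfold korovkinCoeff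
    apply sin_pos_of_pos_of_lt_pi
    · positivity
    · have := pi_pos
      push_cast
      rw [zero_add, one_mul, div_lt_iff₀ (by positivity)]
      nlinarith [(Nat.cast_nonneg m : (0 : ℝ) ≤ m)]
  exact sum_pos' (fun k _ => sq_nonneg _) ⟨0, by simp, by positivity⟩

theorem korovkinCoeff_last (m : ℕ) : korovkinCoeff m (m + 1) = 0 := by
  unfold korovkinCoeff
  have : (((m + 1 : ℕ) : ℝ) + 1) * (π / (m + 2)) = π := by
    push_cast
    field_simp
    ring
  rw [this, sin_pi]

theorem sum_korovkinCoeff_mul_succ (m : ℕ) :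
    ∑ k ∈ range (m + 1), korovkinCoeff m k * korovkinCoeff m (k + 1) =
      cos (π / (m + 2)) * korovkinMass m := by
  have hlast := korovkinCoeff_last m
  have hshift : ∑ k ∈ range (m + 1), korovkinCoeff m k * sin (k * (π / (m + 2))) =
      ∑ k ∈ range (m + 1), korovkinCoeff m k * korovkinCoeff m (k + 1) := by
    rw [sum_range_succ', sum_range_succ, hlast]
    simp only [Nat.cast_zero, zero_mul, sin_zero, mul_zero, add_zero]
    refine sum_congr rfl fun k _ => ?_
    unfold korovkinCoeff
    push_cast
    ring
  have heig : ∀ k : ℕ, 2 * cos (π / (m + 2)) * korovkinCoeff m k =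
      korovkinCoeff m (k + 1) + sin (k * (π / (m + 2))) := by
    intro k
    unfold korovkinCoeff
    have e1 : (((k + 1 : ℕ) : ℝ) + 1) * (π / (m + 2)) =
        (k + 1) * (π / (m + 2)) + π / (m + 2) := by push_cast; ring
    have e2 : (k : ℝ) * (π / (m + 2)) = (k + 1) * (π / (m + 2)) - π / (m + 2) := by ring
    rw [e1, e2, sin_add, sin_sub]
    ring
  have : 2 * (cos (π / (m + 2)) * korovkinMass m) =
      2 * ∑ k ∈ range (m + 1), korovkinCoeff m k * korovkinCoeff m (k + 1) := by
    rw [two_mul (∑ k ∈ range (m + 1), _), ← hshift]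
    nth_rewrite 2 [hshift]
    rw [← sum_add_distrib, korovkinMass, mul_sum, mul_sum]
    refine sum_congr rfl fun k _ => ?_
    linear_combination korovkinCoeff m k * heig k
  linarith

theorem sum_korovkinKernel (m : ℕ) (θ : ℝ) :
    ∑ j ∈ range (m + 2), korovkinKernel m (θ + 2 * π * j / (m + 2 : ℕ)) =
      (m + 2 : ℕ) * korovkinMass m := by
  unfold korovkinKernel
  rw [sum_comm, korovkinMass, mul_sum]
  refine sum_congr rfl fun k hk => ?_
  rw [sum_comm]
  have : ∀ l ∈ range (m + 1), ∑ j ∈ range (m + 2), korovkinCoeff m k * korovkinCoeff m l *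
      cos (((k - l : ℤ) : ℝ) * (θ + 2 * π * j / (m + 2 : ℕ))) =
      if k = l then (m + 2 : ℕ) * korovkinCoeff m k ^ 2 else 0 := by
    intro l hl
    rw [← mul_sum, sum_cos_equispaced]
    · by_cases h : k = l
      · subst h; simp; ring
      · have : (k - l : ℤ) ≠ 0 := by omega
        simp [h, this]
    · simp only [mem_range] at hk hl
      rw [abs_lt]; push_cast; omega
  rw [sum_congr rfl this]
  simp only [sum_ite_eq, if_pos hk]

theorem sum_korovkinKernel_mul_cos (m : ℕ) (θ : ℝ) :
    ∑ j ∈ range (m + 2), korovkinKernel m (θ + 2 * π * j / (m + 2 : ℕ)) *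
        cos (θ + 2 * π * j / (m + 2 : ℕ)) =
      (m + 2 : ℕ) * (cos (π / (m + 2)) * korovkinMass m) := by
  have hlast := korovkinCoeff_last m
  have hterm : ∀ t, korovkinKernel m t * cos t = ∑ k ∈ range (m + 1), ∑ l ∈ range (m + 1),
      korovkinCoeff m k * korovkinCoeff m l / 2 *
        (cos (((k - l + 1 : ℤ) : ℝ) * t) + cos (((k - l - 1 : ℤ) : ℝ) * t)) := by
    intro t
    unfold korovkinKernel
    rw [sum_mul]
    refine sum_congr rfl fun k _ => ?_
    rw [sum_mul]
    refine sum_congr rfl fun l _ => ?_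
    have e1 : ((k - l + 1 : ℤ) : ℝ) * t = ((k - l : ℤ) : ℝ) * t + t := by push_cast; ring
    have e2 : ((k - l - 1 : ℤ) : ℝ) * t = ((k - l : ℤ) : ℝ) * t - t := by push_cast; ring
    rw [e1, e2, cos_add, cos_sub]
    ring
  have hinner : ∀ k ∈ range (m + 1), ∀ l ∈ range (m + 1),
      ∑ j ∈ range (m + 2), korovkinCoeff m k * korovkinCoeff m l / 2 *
        (cos (((k - l + 1 : ℤ) : ℝ) * (θ + 2 * π * j / (m + 2 : ℕ))) +
          cos (((k - l - 1 : ℤ) : ℝ) * (θ + 2 * π * j / (m + 2 : ℕ)))) =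
      (if k + 1 = l then (m + 2 : ℕ) / 2 * (korovkinCoeff m k * korovkinCoeff m l) else 0) +
        (if l + 1 = k then (m + 2 : ℕ) / 2 * (korovkinCoeff m k * korovkinCoeff m l) else 0) := by
    intro k hk l hl
    simp only [mem_range] at hk hl
    rw [← mul_sum, sum_add_distrib, sum_cos_equispaced, sum_cos_equispaced]
    · have h1 : ((k : ℤ) - l + 1 = 0) ↔ k + 1 = l := by omega
      have h2 : ((k : ℤ) - l - 1 = 0) ↔ l + 1 = k := by omega
      simp only [h1, h2]
      split_ifs <;> ring
    · rw [abs_lt]; push_cast; omega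
    · rw [abs_lt]; push_cast; omega
  have hsucc : ∀ k ∈ range (m + 1), ∑ l ∈ range (m + 1), (if k + 1 = l then
      ((m + 2 : ℕ) : ℝ) / 2 * (korovkinCoeff m k * korovkinCoeff m l) else 0) =
      ((m + 2 : ℕ) : ℝ) / 2 * (korovkinCoeff m k * korovkinCoeff m (k + 1)) := by
    intro k hk
    rw [sum_ite_eq]
    split_ifs with h
    · rfl
    · simp only [mem_range] at h hk
      have : k = m := by omega
      rw [this, hlast]; simp
  have hsucc' : ∀ k ∈ range (m + 1), ∑ l ∈ range (m + 1), (if k + 1 = l then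
      ((m + 2 : ℕ) : ℝ) / 2 * (korovkinCoeff m l * korovkinCoeff m k) else 0) =
      ((m + 2 : ℕ) : ℝ) / 2 * (korovkinCoeff m k * korovkinCoeff m (k + 1)) := by
    intro k hk
    rw [← hsucc k hk]
    refine sum_congr rfl fun l _ => ?_
    rw [mul_comm (korovkinCoeff m l)]
  rw [sum_congr rfl fun j _ => hterm _, sum_comm,
    sum_congr rfl fun k _ => sum_comm,
    sum_congr rfl fun k hk => sum_congr rfl (hinner k hk)]
  simp only [sum_add_distrib]
  nth_rewrite 2 [sum_comm]
  rw [sum_congr rfl hsucc, sum_congr rfl hsucc', ← mul_sum, sum_korovkinCoeff_mul_succ]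
  ring

theorem abs_cos_sub_cos_le (θ φ h : ℝ) (hh : 0 < h) :
    |cos θ - cos φ| ≤ ((2 - 2 * cos (θ + φ)) / h + h) / 2 := by
  have h1 : (cos θ - cos φ) ^ 2 ≤ 2 - 2 * cos (θ + φ) := by
    rw [cos_add]
    nlinarith [sq_nonneg (sin θ + sin φ), sin_sq_add_cos_sq θ, sin_sq_add_cos_sq φ]
  rw [← sq_abs] at h1
  have h2 : |cos θ - cos φ| ^ 2 / h ≤ (2 - 2 * cos (θ + φ)) / h := by gcongr
  have h3 : 2 * |cos θ - cos φ| ≤ |cos θ - cos φ| ^ 2 / h + h := by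
    rw [div_add' _ _ _ hh.ne', le_div_iff₀ hh]
    nlinarith [sq_nonneg (|cos θ - cos φ| - h)]
  linarith

theorem sum_korovkinKernel_mul_abs_le (m : ℕ) (θ : ℝ) :
    ∑ j ∈ range (m + 2), korovkinKernel m (θ + 2 * π * j / (m + 2 : ℕ)) *
        |cos θ - cos (2 * π * j / (m + 2 : ℕ))| ≤
      (m + 2 : ℕ) * korovkinMass m * (π / (m + 2)) := by
  set h : ℝ := π / (m + 2) with hh
  have hpos : 0 < h := by positivity
  have hS := korovkinMass_pos m
  calc _ ≤ ∑ j ∈ range (m + 2), korovkinKernel m (θ + 2 * π * j / (m + 2 : ℕ)) *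
        (((2 - 2 * cos (θ + 2 * π * j / (m + 2 : ℕ))) / h + h) / 2) :=
        sum_le_sum fun j _ => mul_le_mul_of_nonneg_left (abs_cos_sub_cos_le _ _ _ hpos)
          (korovkinKernel_nonneg _ _)
    _ = (1 / h + h / 2) * ∑ j ∈ range (m + 2),
          korovkinKernel m (θ + 2 * π * j / (m + 2 : ℕ)) -
        1 / h * ∑ j ∈ range (m + 2), korovkinKernel m (θ + 2 * π * j / (m + 2 : ℕ)) *
          cos (θ + 2 * π * j / (m + 2 : ℕ)) := by
        rw [mul_sum, mul_sum, ← sum_sub_distrib]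
        refine sum_congr rfl fun j _ => ?_
        ring
    _ = (m + 2 : ℕ) * korovkinMass m * ((1 - cos h) / h + h / 2) := by
        rw [sum_korovkinKernel, sum_korovkinKernel_mul_cos]
        ring
    _ ≤ _ := by
        gcongr
        have : (1 - cos h) / h ≤ h / 2 := by
          rw [div_le_iff₀ hpos]
          nlinarith [one_sub_sq_div_two_le_cos (x := h)]
        linarith

/-- **Jackson's theorem** for Lipschitz functions on `[-1, 1]`. -/
theorem exists_polynomial_near_of_lipschitz (f : ℝ → ℝ) (M : ℝ)
    (hf : ∀ x ∈ Set.Icc (-1 : ℝ) 1, ∀ y ∈ Set.Icc (-1 : ℝ) 1, |f x - f y| ≤ M * |x - y|) (m : ℕ) :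
    ∃ p : Polynomial ℝ, p.natDegree ≤ m ∧
      ∀ x ∈ Set.Icc (-1 : ℝ) 1, |f x - p.eval x| ≤ M * (π / (m + 2)) := by
  have hM : 0 ≤ M := by
    have := (abs_nonneg _).trans (hf 1 (by simp) 0 (by simp))
    simpa using this
  set S := korovkinMass m with hSdef
  have hS : 0 < S := korovkinMass_pos m
  set N : ℝ := ((m + 2 : ℕ) : ℝ) with hN
  have hNpos : 0 < N := by rw [hN]; positivity
  set φ : ℕ → ℝ := fun j => 2 * π * j / (m + 2 : ℕ) with hφ
  refine ⟨∑ j ∈ range (m + 2), Polynomial.C (f (cos (φ j)) / (N * S)) *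
    ∑ k ∈ range (m + 1), ∑ l ∈ range (m + 1),
      Polynomial.C (korovkinCoeff m k * korovkinCoeff m l * cos (((k - l : ℤ) : ℝ) * φ j)) *
        Polynomial.Chebyshev.T ℝ (k - l : ℤ), ?_, ?_⟩
  · refine Polynomial.natDegree_sum_le_of_forall_le _ _ fun j _ => ?_
    refine (Polynomial.natDegree_C_mul_le _ _).trans ?_
    refine Polynomial.natDegree_sum_le_of_forall_le _ _ fun k hk => ?_
    refine Polynomial.natDegree_sum_le_of_forall_le _ _ fun l hl => ?_
    refine (Polynomial.natDegree_C_mul_le _ _).trans ?_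
    rw [Polynomial.Chebyshev.natDegree_T]
    simp only [mem_range] at hk hl
    omega
  · intro x hx
    obtain ⟨θ, rfl⟩ : ∃ θ, cos θ = x := ⟨arccos x, cos_arccos hx.1 hx.2⟩
    have hcos : ∀ t, cos t ∈ Set.Icc (-1 : ℝ) 1 := fun t => ⟨neg_one_le_cos t, cos_le_one t⟩
    set W : ℕ → ℝ := fun j =>
      (korovkinKernel m (θ + φ j) + korovkinKernel m (-θ + φ j)) / 2 with hW
    have hWnn : ∀ j, 0 ≤ W j := fun j => by
      have := korovkinKernel_nonneg m (θ + φ j)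
      have := korovkinKernel_nonneg m (-θ + φ j)
      simp only [hW]
      linarith
    have hWeq : ∀ j, ∑ k ∈ range (m + 1), ∑ l ∈ range (m + 1),
        korovkinCoeff m k * korovkinCoeff m l * cos (((k - l : ℤ) : ℝ) * φ j) *
          cos (((k - l : ℤ) : ℝ) * θ) = W j := by
      intro j
      simp only [hW, korovkinKernel]
      rw [← sum_add_distrib, sum_div]
      refine sum_congr rfl fun k _ => ?_
      rw [← sum_add_distrib, sum_div]
      refine sum_congr rfl fun l _ => ?_
      have e2 : ((k - l : ℤ) : ℝ) * (-θ + φ j) =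
        ((k - l : ℤ) : ℝ) * φ j - ((k - l : ℤ) : ℝ) * θ := by ring
      rw [e2, mul_add, cos_add, cos_sub]
      ring
    have hWsum : ∑ j ∈ range (m + 2), W j = N * S := by
      simp only [hW]
      rw [← sum_div, sum_add_distrib, sum_korovkinKernel, sum_korovkinKernel]
      ring
    have hWabs : ∑ j ∈ range (m + 2), W j * |cos θ - cos (φ j)| ≤ N * S * (π / (m + 2)) := by
      have h1 := sum_korovkinKernel_mul_abs_le m θ
      have h2 := sum_korovkinKernel_mul_abs_le m (-θ)
      rw [cos_neg] at h2
      have : ∑ j ∈ range (m + 2), W j * |cos θ - cos (φ j)| =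
          (∑ j ∈ range (m + 2), korovkinKernel m (θ + φ j) * |cos θ - cos (φ j)| +
            ∑ j ∈ range (m + 2), korovkinKernel m (-θ + φ j) * |cos θ - cos (φ j)|) / 2 := by
        rw [← sum_add_distrib, sum_div]
        refine sum_congr rfl fun j _ => ?_
        simp only [hW]
        ring
      rw [this]
      linarith
    have heval : Polynomial.eval (cos θ) (∑ j ∈ range (m + 2),
        Polynomial.C (f (cos (φ j)) / (N * S)) *
        ∑ k ∈ range (m + 1), ∑ l ∈ range (m + 1),
          Polynomial.C (korovkinCoeff m k * korovkinCoeff m l * cos (((k - l : ℤ) : ℝ) * φ j)) *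
          Polynomial.Chebyshev.T ℝ (k - l : ℤ)) =
        ∑ j ∈ range (m + 2), f (cos (φ j)) / (N * S) * W j := by
      simp only [Polynomial.eval_finsetSum, Polynomial.eval_mul, Polynomial.eval_C,
        Polynomial.Chebyshev.T_real_cos]
      refine sum_congr rfl fun j _ => ?_
      rw [hWeq]
    have hdiff : f (cos θ) - ∑ j ∈ range (m + 2), f (cos (φ j)) / (N * S) * W j =
        (∑ j ∈ range (m + 2), W j * (f (cos θ) - f (cos (φ j)))) / (N * S) := by
      rw [eq_div_iff (by positivity), sub_mul]
      nth_rewrite 1 [← hWsum]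
      rw [mul_sum, sum_mul, ← sum_sub_distrib]
      refine sum_congr rfl fun j _ => ?_
      field_simp
    rw [heval, hdiff, abs_div, abs_of_pos (mul_pos hNpos hS), div_le_iff₀ (mul_pos hNpos hS)]
    calc _ ≤ ∑ j ∈ range (m + 2), |W j * (f (cos θ) - f (cos (φ j)))| := abs_sum_le_sum_abs _ _
      _ ≤ ∑ j ∈ range (m + 2), M * (W j * |cos θ - cos (φ j)|) := by
          refine sum_le_sum fun j _ => ?_
          rw [abs_mul, abs_of_nonneg (hWnn j)]
          have := mul_le_mul_of_nonneg_left (hf _ (hcos θ) _ (hcos (φ j))) (hWnn j)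
          linarith
      _ ≤ M * (N * S * (π / (m + 2))) := by
          rw [← mul_sum]
          exact mul_le_mul_of_nonneg_left hWabs hM
      _ = _ := by ring

end Jackson

section Approximation

open Real

theorem exists_polynomial_near_of_lipschitz_Icc {a b : ℝ} (hab : a < b) (f : ℝ → ℝ) (M : ℝ)
    (hf : ∀ x ∈ Set.Icc a b, ∀ y ∈ Set.Icc a b, |f x - f y| ≤ M * |x - y|) (m : ℕ) :
    ∃ p : Polynomial ℝ, p.natDegree ≤ m ∧
      ∀ x ∈ Set.Icc a b, |f x - p.eval x| ≤ M * ((b - a) / 2) * (π / (m + 2)) := by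
  have hba : 0 < b - a := sub_pos.2 hab
  have hmap : ∀ t ∈ Set.Icc (-1 : ℝ) 1, (a + b) / 2 + (b - a) / 2 * t ∈ Set.Icc a b := by
    rintro t ⟨h1, h2⟩
    constructor <;> nlinarith
  obtain ⟨p, hpd, hp⟩ := exists_polynomial_near_of_lipschitz
    (fun t => f ((a + b) / 2 + (b - a) / 2 * t)) (M * ((b - a) / 2)) (by
      intro x hx y hy
      refine (hf _ (hmap x hx) _ (hmap y hy)).trans_eq ?_
      rw [add_sub_add_left_eq_sub, ← mul_sub, abs_mul, abs_of_pos (by positivity : 0 < (b - a) / 2),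
        mul_assoc]) m
  refine ⟨p.comp (Polynomial.C (2 / (b - a)) * Polynomial.X +
    Polynomial.C (-(a + b) / (b - a))), ?_, ?_⟩
  · rw [Polynomial.natDegree_comp]
    calc _ ≤ p.natDegree * 1 := Nat.mul_le_mul_left _ Polynomial.natDegree_linear_le
      _ ≤ m := by simpa using hpd
  · intro x hx
    have ht : 2 / (b - a) * x + -(a + b) / (b - a) ∈ Set.Icc (-1 : ℝ) 1 := by
      have e : 2 / (b - a) * x + -(a + b) / (b - a) = (2 * x - (a + b)) / (b - a) := by ring
      rw [e]
      constructor
      · rw [le_div_iff₀ hba]; linarith [hx.1]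
      · rw [div_le_iff₀ hba]; linarith [hx.2]
    have := hp _ ht
    have e : (a + b) / 2 + (b - a) / 2 * (2 / (b - a) * x + -(a + b) / (b - a)) = x := by
      field_simp
      ring
    rw [e] at this
    simpa [Polynomial.eval_comp] using this

theorem Polynomial.exists_derivative_eq (p : Polynomial ℝ) :
    ∃ P : Polynomial ℝ, P.derivative = p ∧ P.natDegree ≤ p.natDegree + 1 := by
  refine ⟨∑ i ∈ Finset.range (p.natDegree + 1),
    Polynomial.monomial (i + 1) (p.coeff i / (i + 1)), ?_, ?_⟩
  · conv_rhs => rw [p.as_sum_range]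
    rw [Polynomial.derivative_sum]
    refine Finset.sum_congr rfl fun i _ => ?_
    rw [Polynomial.derivative_monomial]
    have : (i : ℝ) + 1 ≠ 0 := by positivity
    push_cast
    rw [div_mul_cancel₀ _ this]
  · refine Polynomial.natDegree_sum_le_of_forall_le _ _ fun i hi => ?_
    refine (Polynomial.natDegree_monomial_le _).trans ?_
    simp only [Finset.mem_range] at hi
    omega

/-- Best approximation by polynomials of degree `m` using `k ≤ m` derivatives. -/
theorem exists_polynomial_near_of_hasDerivAt {a b : ℝ} (hab : a < b) (M : ℝ) :
    ∀ (k m : ℕ) (_ : k ≤ m) (F : ℕ → ℝ → ℝ)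
      (_ : ∀ j, ∀ x ∈ Set.Icc a b, HasDerivAt (F j) (F (j + 1) x) x)
      (_ : ∀ x ∈ Set.Icc a b, |F k x| ≤ M),
      ∃ p : Polynomial ℝ, p.natDegree ≤ m ∧ ∀ x ∈ Set.Icc a b,
        |F 0 x - p.eval x| ≤ M * (2 * (b - a)) ^ k / (m.descFactorial k) := by
  intro k
  induction k with
  | zero =>
    intro m _ F _ hM
    exact ⟨0, by simp, fun x hx => by simpa using hM x hx⟩
  | succ k ih =>
    intro m hkm F hF hM
    obtain ⟨n, rfl⟩ : ∃ n, m = n + 1 := ⟨m - 1, by omega⟩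
    obtain ⟨p, hpd, hp⟩ := ih n (by omega) (fun j => F (j + 1)) (fun j => hF (j + 1)) hM
    obtain ⟨P, hP, hPd⟩ := p.exists_derivative_eq
    set ε : ℝ := M * (2 * (b - a)) ^ k / (n.descFactorial k) with hε
    have hlip : ∀ x ∈ Set.Icc a b, ∀ y ∈ Set.Icc a b,
        |(F 0 x - P.eval x) - (F 0 y - P.eval y)| ≤ ε * |x - y| := by
      intro x hx y hy
      refine (convex_Icc a b).norm_image_sub_le_of_norm_hasDerivWithin_le
        (f := fun x => F 0 x - P.eval x) (f' := fun x => F 1 x - p.eval x)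
        (fun z hz => ?_) hp hy hx
      have h1 := (hF 0 z hz).sub (P.hasDerivAt z)
      rw [hP] at h1
      exact h1.hasDerivWithinAt
    obtain ⟨Q, hQd, hQ⟩ := exists_polynomial_near_of_lipschitz_Icc hab _ ε hlip (n + 1)
    refine ⟨Q + P, (Polynomial.natDegree_add_le _ _).trans (max_le hQd (by omega)), ?_⟩
    intro x hx
    have hx' := hQ x hx
    have hε0 : 0 ≤ ε := (abs_nonneg _).trans (hp x hx)
    have hba : 0 < b - a := sub_pos.2 hab
    rw [Polynomial.eval_add]
    have e : F 0 x - (Q.eval x + P.eval x) = F 0 x - P.eval x - Q.eval x := by ring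
    rw [e]
    refine hx'.trans ?_
    have hπ : π / (((n + 1 : ℕ) : ℝ) + 2) ≤ 4 / (n + 1) := by
      push_cast
      rw [div_le_div_iff₀ (by positivity) (by positivity)]
      nlinarith [pi_le_four, pi_pos, (Nat.cast_nonneg n : (0 : ℝ) ≤ n)]
    calc _ ≤ ε * ((b - a) / 2) * (4 / (n + 1)) := by gcongr
      _ = _ := by
        rw [Nat.succ_descFactorial_succ, hε]
        push_cast
        have : ((n.descFactorial k : ℕ) : ℝ) ≠ 0 := by
          have : n.descFactorial k ≠ 0 := by
            rw [Ne, Nat.descFactorial_eq_zero_iff_lt]; omega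
          exact_mod_cast this
        field_simp
        ring

end Approximation

section Rate

open Real

theorem rpow_descFactorial_le {δ : ℝ} (hδ : 1 ≤ δ) {N m : ℕ} (hN : (N : ℝ) ^ δ ≤ m)
    (k : ℕ) (hk : k ≤ N) :
    ((N.descFactorial k : ℕ) : ℝ) ^ δ ≤ m.descFactorial k := by
  have hNm : N ≤ m := by
    rcases Nat.eq_zero_or_pos N with h | h
    · omega
    · have h1 : (1 : ℝ) ≤ N := by exact_mod_cast h
      have : (N : ℝ) ≤ m := (self_le_rpow_of_one_le h1 hδ).trans hN
      exact_mod_cast this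
  rw [Nat.descFactorial_eq_prod_range, Nat.descFactorial_eq_prod_range]
  push_cast
  rw [← Real.finsetProd_rpow _ _ (fun i _ => by positivity)]
  refine Finset.prod_le_prod (fun i _ => by positivity) fun i hi => ?_
  have hi' : i < k := Finset.mem_range.1 hi
  have hiN : i ≤ N := by omega
  rw [Nat.cast_sub hiN, Nat.cast_sub (hiN.trans hNm)]
  have h1 : ((N : ℝ) - i) ^ δ + (i : ℝ) ^ δ ≤ (N : ℝ) ^ δ := by
    have := add_rpow_le_rpow_add (p := δ) (a := (N : ℝ) - i) (b := i)
      (sub_nonneg.2 (by exact_mod_cast hiN)) (by positivity) hδ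
    simpa using this
  have h2 : (i : ℝ) ≤ (i : ℝ) ^ δ := by
    rcases Nat.eq_zero_or_pos i with h | h
    · subst h; simp; positivity
    · exact self_le_rpow_of_one_le (by exact_mod_cast h) hδ
  linarith

/-- Optimising the number of derivatives. -/
theorem exists_factorial_rate_le {δ B : ℝ} (hδ : 1 ≤ δ) (hB : 0 < B) {N m : ℕ}
    (hN : (N : ℝ) ^ δ ≤ m) :
    ∃ k ≤ N, B ^ k * ((k.factorial : ℕ) : ℝ) ^ δ / (m.descFactorial k) ≤
      ((N : ℝ) + 1) ^ δ * (B / (1 + B)) ^ N := by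
  have hδ0 : 0 < δ := by linarith
  set z : ℝ := B ^ (-(1 / δ)) with hz
  have hzpos : 0 < z := rpow_pos_of_pos hB _
  have hzδ : z ^ δ = B⁻¹ := by
    rw [hz, ← rpow_mul hB.le, neg_mul, one_div_mul_cancel hδ0.ne', rpow_neg_one]
  obtain ⟨k, hk, hmax⟩ : ∃ k ∈ Finset.range (N + 1),
      (1 + z) ^ N / (N + 1) ≤ N.choose k * z ^ k := by
    by_contra! hcon
    have h1 : (1 + z) ^ N = ∑ k ∈ Finset.range (N + 1), (N.choose k : ℝ) * z ^ k := by
      rw [add_comm, add_pow]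
      refine Finset.sum_congr rfl fun k _ => ?_
      simp [mul_comm]
    have h2 := Finset.sum_lt_sum_of_nonempty (by simp) hcon
    rw [← h1] at h2
    simp only [Finset.sum_const, Finset.card_range, nsmul_eq_mul] at h2
    push_cast at h2
    rw [mul_div_cancel₀ _ (by positivity)] at h2
    exact lt_irrefl _ h2
  have hkN : k ≤ N := by simpa [Nat.lt_succ_iff] using hk
  refine ⟨k, hkN, ?_⟩
  have hd := rpow_descFactorial_le hδ hN k hkN
  have hdpos : (0 : ℝ) < N.descFactorial k := by
    have : 0 < N.descFactorial k := Nat.pos_of_ne_zero (by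
      rw [Ne, Nat.descFactorial_eq_zero_iff_lt]; omega)
    exact_mod_cast this
  have hkfac : (0 : ℝ) < k.factorial := by exact_mod_cast k.factorial_pos
  have hcpos : (0 : ℝ) < N.choose k := by exact_mod_cast Nat.choose_pos hkN
  have hchoose : (N.descFactorial k : ℝ) = k.factorial * N.choose k := by
    exact_mod_cast Nat.descFactorial_eq_factorial_mul_choose N k
  have hstep : B ^ k * ((k.factorial : ℕ) : ℝ) ^ δ / (m.descFactorial k) ≤
      ((N.choose k * z ^ k) ^ δ)⁻¹ := by
    have e : ((N.choose k * z ^ k : ℝ) ^ δ)⁻¹ =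
        B ^ k * ((k.factorial : ℕ) : ℝ) ^ δ / (N.descFactorial k : ℝ) ^ δ := by
      rw [hchoose, mul_rpow hkfac.le hcpos.le, mul_rpow hcpos.le (by positivity),
        ← rpow_natCast z, ← rpow_mul hzpos.le, mul_comm (k : ℝ), rpow_mul hzpos.le, hzδ,
        rpow_natCast, inv_pow]
      have := (rpow_pos_of_pos hkfac δ).ne'
      have := (rpow_pos_of_pos hcpos δ).ne'
      field_simp
    rw [e]
    gcongr
  refine hstep.trans ?_
  have hlow : ((1 + z) ^ N / (N + 1) : ℝ) ^ δ ≤ (N.choose k * z ^ k : ℝ) ^ δ := by gcongr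
  have hbase : 1 + B⁻¹ ≤ (1 + z) ^ δ := by
    have := add_rpow_le_rpow_add (p := δ) (a := 1) (b := z) zero_le_one hzpos.le hδ
    rwa [one_rpow, hzδ] at this
  calc _ ≤ (((1 + z) ^ N / (N + 1) : ℝ) ^ δ)⁻¹ := by gcongr
    _ = ((N : ℝ) + 1) ^ δ * (((1 + z) ^ δ) ^ N)⁻¹ := by
      rw [div_rpow (by positivity) (by positivity), ← rpow_natCast (1 + z),
        ← rpow_mul (by positivity), mul_comm (N : ℝ), rpow_mul (by positivity), rpow_natCast,
        inv_div, div_eq_mul_inv]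
    _ ≤ ((N : ℝ) + 1) ^ δ * ((1 + B⁻¹) ^ N)⁻¹ := by gcongr
    _ = _ := by
      rw [← inv_pow]
      congr 2
      field_simp
      ring

theorem min_rate_lt {s : ℝ} (hs : 0 < s) :
    4 * s / (1 + 4 * s) < min (s / (s + 1)) (s / 2) ^ (1 / exp 2) := by
  have hr1 : 4 * s / (1 + 4 * s) < 1 := by rw [div_lt_one (by positivity)]; linarith
  have hr0 : 0 < 4 * s / (1 + 4 * s) := by positivity
  have he : (4 : ℝ) ≤ exp 2 := by
    have := add_one_le_exp (1 : ℝ)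
    have h2 : exp 2 = exp 1 * exp 1 := by rw [← exp_add]; norm_num
    nlinarith
  have h4 : (4 * s / (1 + 4 * s)) ^ 4 < min (s / (s + 1)) (s / 2) := by
    rw [div_pow, lt_min_iff, div_lt_div_iff₀ (by positivity) (by positivity),
      div_lt_div_iff₀ (by positivity) (by positivity)]
    constructor
    · nlinarith [pow_pos hs 2, pow_pos hs 3]
    · have h : 0 < s ^ 3 * (256 * s ^ 2 - 256 * s + 96) :=
        mul_pos (pow_pos hs 3) (by nlinarith [sq_nonneg (2 * s - 1)])
      nlinarith [pow_pos hs 2, pow_pos hs 3]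
  have hexp : (4 * s / (1 + 4 * s)) ^ exp 2 < min (s / (s + 1)) (s / 2) := by
    refine lt_of_le_of_lt ?_ h4
    rw [← rpow_natCast]
    exact rpow_le_rpow_of_exponent_ge hr0 hr1.le (by exact_mod_cast he)
  have := rpow_lt_rpow (by positivity) hexp (by positivity : 0 < 1 / exp 2)
  rwa [← rpow_mul hr0.le, mul_one_div_cancel (exp_pos 2).ne', rpow_one] at this

/-- Stretched exponential decay beats polynomial growth. -/
theorem exists_forall_rpow_mul_stretched_le {δ μ θ : ℝ} (hδ : 1 ≤ δ) (hμ : 0 ≤ μ) (hθ0 : 0 < θ)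
    (hθ1 : θ < 1) :
    ∃ K : ℝ, 0 < K ∧ ∀ m : ℕ, 1 ≤ m → ((m : ℝ) + 1) ^ μ * θ ^ ((m : ℝ) ^ (1 / δ)) ≤ K := by
  have hδ0 : 0 < δ := by linarith
  have hb : 0 < -log θ := neg_pos.2 (log_neg hθ0 hθ1)
  have ht := (tendsto_rpow_mul_exp_neg_mul_atTop_nhds_zero (δ * μ) _ hb).comp
    ((tendsto_rpow_atTop (by positivity : 0 < 1 / δ)).comp
      (tendsto_natCast_atTop_atTop (R := ℝ)))
  obtain ⟨K, hK⟩ := ht.bddAbove_range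
  have hK' : ∀ m : ℕ, ((m : ℝ) ^ (1 / δ)) ^ (δ * μ) * exp (- -log θ * (m : ℝ) ^ (1 / δ)) ≤ K :=
    fun m => hK ⟨m, rfl⟩
  refine ⟨2 ^ μ * (|K| + 1), by positivity, fun m hm => ?_⟩
  have hm1 : (1 : ℝ) ≤ m := by exact_mod_cast hm
  have h1 : ((m : ℝ) + 1) ^ μ ≤ 2 ^ μ * (m : ℝ) ^ μ := by
    rw [← mul_rpow (by norm_num) (by positivity)]
    exact rpow_le_rpow (by positivity) (by linarith) hμ
  have h2 := hK' m
  rw [neg_neg, ← rpow_mul (by positivity), ← mul_assoc, one_div_mul_cancel hδ0.ne', one_mul,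
    ← rpow_def_of_pos hθ0] at h2
  calc _ ≤ 2 ^ μ * (m : ℝ) ^ μ * θ ^ ((m : ℝ) ^ (1 / δ)) := by gcongr
    _ = 2 ^ μ * ((m : ℝ) ^ μ * θ ^ ((m : ℝ) ^ (1 / δ))) := by ring
    _ ≤ _ := by
      gcongr
      linarith [le_abs_self K]

end Rate

section Interpolation

theorem abs_eval_interpolate_le {a b Λ : ℝ} {m : ℕ} {v : Fin (m + 1) → ℝ}
    (hinj : Function.Injective v)
    (hstab : ∀ u : ℝ → ℝ, ContinuousOn u (Set.Icc a b) →
      ∀ M : ℝ, (∀ x ∈ Set.Icc a b, |u x| ≤ M) → ∀ y ∈ Set.Icc a b,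
        |(Lagrange.interpolate Finset.univ v (fun j => u (v j))).eval y| ≤ Λ * M)
    (w : Fin (m + 1) → ℝ) (M : ℝ) (hw : ∀ j, |w j| ≤ M) {y : ℝ} (hy : y ∈ Set.Icc a b) :
    |(Lagrange.interpolate Finset.univ v w).eval y| ≤ Λ * M := by
  have hM : 0 ≤ M := (abs_nonneg _).trans (hw 0)
  set P := Lagrange.interpolate Finset.univ v w with hP
  have hPv : ∀ j, P.eval (v j) = w j := fun j =>
    Lagrange.eval_interpolate_at_node _ hinj.injOn (Finset.mem_univ j)
  have h := hstab (fun t => max (-M) (min M (P.eval t)))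
    (by fun_prop) M (fun x _ => abs_le.2 ⟨le_max_left _ _,
      max_le (by linarith) (min_le_left _ _)⟩) y hy
  have e : (fun j => max (-M) (min M (P.eval (v j)))) = w := by
    funext j
    rw [hPv, min_eq_right (abs_le.1 (hw j)).2, max_eq_right (abs_le.1 (hw j)).1]
  rwa [e] at h

theorem abs_sub_eval_interpolate_le {a b Λ ε : ℝ} {m : ℕ} {v : Fin (m + 1) → ℝ}
    (hinj : Function.Injective v) (hmem : ∀ j, v j ∈ Set.Icc a b)
    (hstab : ∀ (w : Fin (m + 1) → ℝ) (M : ℝ), (∀ j, |w j| ≤ M) → ∀ y ∈ Set.Icc a b,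
      |(Lagrange.interpolate Finset.univ v w).eval y| ≤ Λ * M)
    (u : ℝ → ℝ) (p : Polynomial ℝ) (hpd : p.natDegree ≤ m)
    (hp : ∀ x ∈ Set.Icc a b, |u x - p.eval x| ≤ ε) {y : ℝ} (hy : y ∈ Set.Icc a b) :
    |u y - (Lagrange.interpolate Finset.univ v (fun j => u (v j))).eval y| ≤ (1 + Λ) * ε := by
  have hpI : p = Lagrange.interpolate Finset.univ v fun j => p.eval (v j) := by
    refine Lagrange.eq_interpolate hinj.injOn ?_
    refine lt_of_le_of_lt Polynomial.degree_le_natDegree ?_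
    simp only [Finset.card_univ, Fintype.card_fin]
    exact_mod_cast Nat.lt_succ_of_le hpd
  have hdiff : Lagrange.interpolate Finset.univ v (fun j => u (v j) - p.eval (v j)) =
      Lagrange.interpolate Finset.univ v (fun j => u (v j)) - p := by
    nth_rewrite 2 [hpI]
    rw [← map_sub]
    rfl
  have h1 := hstab (fun j => u (v j) - p.eval (v j)) ε (fun j => hp _ (hmem j)) y hy
  rw [hdiff, Polynomial.eval_sub] at h1
  have h2 := hp y hy
  rw [abs_le] at *
  constructor <;> linarith [h1.1, h1.2, h2.1, h2.2]

end Interpolation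

section Composition

theorem List.foldr_comp_of_forall_eq_id {α : Type*} (l : List (α → α)) (h : ∀ T ∈ l, T = id)
    (z : α → α) : l.foldr (· ∘ ·) z = z := by
  induction l with
  | nil => rfl
  | cons T l ih =>
    rw [List.foldr_cons, ih fun S hS => h S (List.mem_cons_of_mem _ hS),
      h T List.mem_cons_self, Function.id_comp]

theorem List.foldr_comp_map_of_forall_ne {α ι : Type*} (F : ι → α → α) (i : ι)
    (hF : ∀ j, j ≠ i → F j = id) (l : List ι) (hl : l.Nodup) (hi : i ∈ l) :
    (l.map F).foldr (· ∘ ·) id = F i := by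
  induction l with
  | nil => simp at hi
  | cons j l ih =>
    rw [List.map_cons, List.foldr_cons]
    rw [List.nodup_cons] at hl
    by_cases hj : j = i
    · subst hj
      rw [List.foldr_comp_of_forall_eq_id, Function.comp_id]
      intro T hT
      obtain ⟨k, hk, rfl⟩ := List.mem_map.1 hT
      exact hF k fun h => hl.1 (h ▸ hk)
    · rw [ih hl.2 ((List.mem_cons.1 hi).resolve_left (Ne.symm hj)), hF j hj, Function.id_comp]

/-- Telescoping error bound for compositions of stable operators. -/
theorem abs_sub_foldr_comp_le {X : Type*} (R S : Set X) (g : X → X → ℝ) {Λ E : ℝ} (hΛ : 1 ≤ Λ)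
    (hE : 0 ≤ E) (l : List ((X → X → ℝ) → (X → X → ℝ)))
    (hsub : ∀ T ∈ l, ∀ h₁ h₂ : X → X → ℝ, T (h₁ - h₂) = T h₁ - T h₂)
    (hstab : ∀ T ∈ l, ∀ (h : X → X → ℝ) (M : ℝ), (∀ x ∈ R, ∀ y ∈ S, |h x y| ≤ M) →
      ∀ x ∈ R, ∀ y ∈ S, |T h x y| ≤ Λ * M)
    (herr : ∀ T ∈ l, ∀ x ∈ R, ∀ y ∈ S, |g x y - T g x y| ≤ E) :
    ∀ x ∈ R, ∀ y ∈ S, |g x y - l.foldr (· ∘ ·) id g x y| ≤ l.length * Λ ^ l.length * E := by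
  induction l with
  | nil => simp
  | cons T l ih =>
    have hih := ih (fun S hS => hsub S (List.mem_cons_of_mem _ hS))
      (fun S hS => hstab S (List.mem_cons_of_mem _ hS))
      (fun S hS => herr S (List.mem_cons_of_mem _ hS))
    intro x hx y hy
    have h1 := herr T List.mem_cons_self x hx y hy
    have h2 := hstab T List.mem_cons_self (g - l.foldr (· ∘ ·) id g) _ hih x hx y hy
    rw [hsub T List.mem_cons_self] at h2
    have e : g x y - (T :: l).foldr (· ∘ ·) id g x y =
        (g x y - T g x y) + (T g - T (l.foldr (· ∘ ·) id g)) x y := by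
      simp only [List.foldr_cons, Function.comp_apply, Pi.sub_apply]
      ring
    rw [e]
    refine (abs_add_le _ _).trans ((add_le_add h1 h2).trans ?_)
    have h3 : E ≤ Λ ^ (l.length + 1) * E := le_mul_of_one_le_left hE (one_le_pow₀ hΛ)
    rw [List.length_cons]
    push_cast
    calc _ ≤ Λ ^ (l.length + 1) * E + Λ * (l.length * Λ ^ l.length * E) := by gcongr
      _ = _ := by ring

end Composition

section Gevrey

variable {d : ℕ}

theorem update_mem_box {a b x : Fin d → ℝ} (hx : x ∈ box a b) (i : Fin d) {t : ℝ}
    (ht : t ∈ Set.Icc (a i) (b i)) : Function.update x i t ∈ box a b := by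
  intro j
  by_cases h : j = i
  · subst h; simpa using ht
  · simpa [h] using hx j

theorem pderivX_iterate (i : Fin d) (g : (Fin d → ℝ) → (Fin d → ℝ) → ℝ) (k : ℕ)
    (x y : Fin d → ℝ) :
    (pderivX i)^[k] g x y = iteratedDeriv k (fun t => g (Function.update x i t) y) (x i) := by
  induction k generalizing x with
  | zero => simp
  | succ k ih =>
    rw [Function.iterate_succ_apply', iteratedDeriv_succ, pderivX]
    congr 1
    funext t
    rw [ih]
    simp

theorem pderivY_iterate (i : Fin d) (g : (Fin d → ℝ) → (Fin d → ℝ) → ℝ) (k : ℕ)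
    (x y : Fin d → ℝ) :
    (pderivY i)^[k] g x y = iteratedDeriv k (fun t => g x (Function.update y i t)) (y i) := by
  induction k generalizing y with
  | zero => simp
  | succ k ih =>
    rw [Function.iterate_succ_apply', iteratedDeriv_succ, pderivY]
    congr 1
    funext t
    rw [ih]
    simp

theorem mderivXY_single_left (i : Fin d) (k : ℕ) (g : (Fin d → ℝ) → (Fin d → ℝ) → ℝ) :
    mderivXY (Pi.single i k) 0 g = (pderivX i)^[k] g := by
  unfold mderivXY
  rw [List.foldr_append, List.foldr_comp_of_forall_eq_id
    (List.ofFn fun j => (pderivY j)^[(0 : Fin d → ℕ) j]) (by simp),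
    List.ofFn_eq_map, List.foldr_comp_map_of_forall_ne _ i _ _ (List.nodup_finRange d)
      (List.mem_finRange i)]
  · simp
  · intro j hj
    simp [hj]

theorem mderivXY_single_right (i : Fin d) (k : ℕ) (g : (Fin d → ℝ) → (Fin d → ℝ) → ℝ) :
    mderivXY 0 (Pi.single i k) g = (pderivY i)^[k] g := by
  unfold mderivXY
  rw [List.foldr_append, List.foldr_comp_of_forall_eq_id (List.ofFn _) (by simp),
    List.ofFn_eq_map, List.foldr_comp_map_of_forall_ne _ i _ _ (List.nodup_finRange d)
      (List.mem_finRange i)]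
  · simp
  · intro j hj
    simp [hj]

theorem ContDiffOn.hasDerivAt_iteratedDeriv {u : ℝ → ℝ} {V : Set ℝ} (hV : IsOpen V)
    (hu : ContDiffOn ℝ (⊤ : ℕ∞) u V) (j : ℕ) {t : ℝ} (ht : t ∈ V) :
    HasDerivAt (iteratedDeriv j u) (iteratedDeriv (j + 1) u t) t := by
  rw [iteratedDeriv_succ]
  refine DifferentiableAt.hasDerivAt ?_
  have h1 := hu.differentiableOn_iteratedDerivWithin (m := j)
    (by exact_mod_cast ENat.natCast_lt_top j) hV.uniqueDiffOn
  exact ((h1.congr fun x hx => (iteratedDerivWithin_of_isOpen hV hx).symm) t ht).differentiableAt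
    (hV.mem_nhds ht)

theorem euclDist_nonneg (x y : Fin d → ℝ) : 0 ≤ euclDist x y := Real.sqrt_nonneg _

theorem setDist2_le_euclDist {R S : Set (Fin d → ℝ)} {x y : Fin d → ℝ} (hx : x ∈ R) (hy : y ∈ S) :
    setDist2 R S ≤ euclDist x y :=
  csInf_le ⟨0, by rintro r ⟨x, _, y, _, rfl⟩; exact euclDist_nonneg x y⟩ ⟨x, hx, y, hy, rfl⟩

theorem sub_le_diamInf (a b : Fin d → ℝ) (i : Fin d) : b i - a i ≤ diamInf a b :=
  le_ciSup (f := fun i => b i - a i) (Set.finite_range _).bddAbove i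

theorem abs_sub_le_diamInf {a b x x' : Fin d → ℝ} (hx : x ∈ box a b) (hx' : x' ∈ box a b)
    (i : Fin d) : |x i - x' i| ≤ diamInf a b := by
  refine le_trans ?_ (sub_le_diamInf a b i)
  rw [abs_le]
  constructor <;> linarith [(hx i).1, (hx i).2, (hx' i).1, (hx' i).2]

theorem abs_sub_le_euclDist (x y : Fin d → ℝ) (i : Fin d) : |x i - y i| ≤ euclDist x y := by
  rw [euclDist, ← Real.sqrt_sq_eq_abs]
  exact Real.sqrt_le_sqrt (Finset.single_le_sum (f := fun i => (x i - y i) ^ 2)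
    (fun i _ => sq_nonneg _) (Finset.mem_univ i))

theorem euclDist_le_of_admissible (hd : 1 ≤ d) {a b a' b' : Fin d → ℝ} {η : ℝ} (hη : 0 < η)
    (hD : 0 < setDist2 (box a b) (box a' b'))
    (hadm : max (diamInf a b) (diamInf a' b') ≤ 2 * η * setDist2 (box a b) (box a' b'))
    {x y : Fin d → ℝ} (hx : x ∈ box a b) (hy : y ∈ box a' b') :
    euclDist x y ≤ d * (4 * η + 2) * setDist2 (box a b) (box a' b') := by
  set D := setDist2 (box a b) (box a' b') with hDdef
  obtain ⟨r, ⟨x₀, hx₀, y₀, hy₀, rfl⟩, hr⟩ := exists_lt_of_csInf_lt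
    (s := {r | ∃ x ∈ box a b, ∃ y ∈ box a' b', r = euclDist x y})
    ⟨_, x, hx, y, hy, rfl⟩ (show setDist2 (box a b) (box a' b') < 2 * D by linarith)
  have hcoord : ∀ i, (x i - y i) ^ 2 ≤ ((4 * η + 2) * D) ^ 2 := by
    intro i
    refine sq_le_sq' ?_ ?_ <;>
    · have h1 := (abs_sub_le_diamInf hx hx₀ i).trans ((le_max_left _ _).trans hadm)
      have h2 := (abs_sub_le_diamInf hy hy₀ i).trans ((le_max_right _ _).trans hadm)
      have h3 := (abs_sub_le_euclDist x₀ y₀ i).trans hr.le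
      rw [abs_le] at h1 h2 h3
      linarith [h1.1, h1.2, h2.1, h2.2, h3.1, h3.2]
  have hd' : (1 : ℝ) ≤ d := by exact_mod_cast hd
  rw [euclDist]
  refine Real.sqrt_le_iff.2 ⟨by positivity, ?_⟩
  calc _ ≤ ∑ _i : Fin d, ((4 * η + 2) * D) ^ 2 := Finset.sum_le_sum fun i _ => hcoord i
    _ = d * ((4 * η + 2) * D) ^ 2 := by simp
    _ ≤ d ^ 2 * ((4 * η + 2) * D) ^ 2 := by
      gcongr
      exact le_self_pow₀ hd' two_ne_zero
    _ = _ := by ring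

theorem rpow_le_of_le_of_le_mul {e D c p : ℝ} (hD : 0 < D) (hc : 1 ≤ c) (h1 : D ≤ e)
    (h2 : e ≤ c * D) : e ^ p ≤ c ^ |p| * D ^ p := by
  rcases le_or_gt 0 p with hp | hp
  · rw [abs_of_nonneg hp, ← Real.mul_rpow (by linarith) hD.le]
    exact Real.rpow_le_rpow (by linarith) h2 hp
  · calc _ ≤ D ^ p := Real.rpow_le_rpow_of_nonpos hD h1 hp.le
      _ ≤ _ := le_mul_of_one_le_left (by positivity) (Real.one_le_rpow hc (abs_nonneg _))

/-- Both pure partial derivative bounds in terms of the distance of the sets. -/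
theorem GevreyAsympSmooth.abs_pderiv_le {δ CG A q D c : ℝ} (hCG : 0 < CG)
    (hA : 0 < A) {R S : Set (Fin d → ℝ)} {g : (Fin d → ℝ) → (Fin d → ℝ) → ℝ}
    (hg : GevreyAsympSmooth δ CG A q R S g) (hD : 0 < D) (hc : 1 ≤ c) {x y : Fin d → ℝ}
    (hx : x ∈ R) (hy : y ∈ S) (hxy : x ≠ y) (h1 : D ≤ euclDist x y) (h2 : euclDist x y ≤ c * D)
    (i : Fin d) (k : ℕ) :
    |(pderivX i)^[k] g x y| ≤ CG * c ^ |-(2 * q + d)| * D ^ (-(2 * q + d)) *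
        ((A / D) ^ k * (k.factorial : ℝ) ^ δ) ∧
      |(pderivY i)^[k] g x y| ≤ CG * c ^ |-(2 * q + d)| * D ^ (-(2 * q + d)) *
        ((A / D) ^ k * (k.factorial : ℝ) ^ δ) := by
  have hepos : 0 < euclDist x y := lt_of_lt_of_le hD h1
  have hfac : ∏ j, ((Pi.single i k : Fin d → ℕ) j).factorial = k.factorial := by
    rw [Finset.prod_eq_single i]
    · simp
    · intro j _ hj; simp [hj]
    · simp
  have hpow : euclDist x y ^ (-(2 * q) - d - k) ≤
      c ^ |-(2 * q + d)| * D ^ (-(2 * q + d)) * (D ^ k)⁻¹ := by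
    have e : -(2 * q) - (d : ℝ) - k = -(2 * q + d) - (k : ℕ) := by ring
    rw [e, Real.rpow_sub_natCast hepos.ne', div_eq_mul_inv]
    gcongr
    exact rpow_le_of_le_of_le_mul hD hc h1 h2
  have hfin : CG * A ^ k * (k.factorial : ℝ) ^ δ * euclDist x y ^ (-(2 * q) - d - k) ≤
      CG * c ^ |-(2 * q + d)| * D ^ (-(2 * q + d)) *
        ((A / D) ^ k * (k.factorial : ℝ) ^ δ) := by
    calc _ ≤ CG * A ^ k * (k.factorial : ℝ) ^ δ *
          (c ^ |-(2 * q + d)| * D ^ (-(2 * q + d)) * (D ^ k)⁻¹) := by gcongr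
      _ = _ := by rw [div_pow]; ring
  constructor
  · have h := hg.2 (Pi.single i k) 0 x hx y hy hxy
    rw [mderivXY_single_left] at h
    refine h.trans (le_trans (le_of_eq ?_) hfin)
    rw [hfac]
    simp
  · have h := hg.2 0 (Pi.single i k) x hx y hy hxy
    rw [mderivXY_single_right] at h
    refine h.trans (le_trans (le_of_eq ?_) hfin)
    rw [hfac]
    simp

/-- Univariate interpolation error for functions with Gevrey-type derivative bounds. -/
theorem abs_sub_eval_interpolate_le_of_gevrey {a b Λ M₀ A D η δ : ℝ} {m k : ℕ} (hab : a < b)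
    (hkm : k ≤ m) (hD : 0 < D) (hη : 0 < η) (hA : 0 < A) (hM₀ : 0 ≤ M₀)
    (hlen : b - a ≤ 2 * η * D)
    {v : Fin (m + 1) → ℝ} (hinj : Function.Injective v) (hmem : ∀ j, v j ∈ Set.Icc a b)
    (hstab : ∀ (w : Fin (m + 1) → ℝ) (M : ℝ), (∀ j, |w j| ≤ M) → ∀ y ∈ Set.Icc a b,
      |(Lagrange.interpolate Finset.univ v w).eval y| ≤ Λ * M)
    {u : ℝ → ℝ} {V : Set ℝ} (hV : IsOpen V) (hVI : Set.Icc a b ⊆ V)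
    (hu : ContDiffOn ℝ (⊤ : ℕ∞) u V)
    (hbd : ∀ t ∈ Set.Icc a b,
      |iteratedDeriv k u t| ≤ M₀ * ((A / D) ^ k * (k.factorial : ℝ) ^ δ))
    {t : ℝ} (ht : t ∈ Set.Icc a b) :
    |u t - (Lagrange.interpolate Finset.univ v (fun j => u (v j))).eval t| ≤
      (1 + Λ) * (M₀ * ((4 * (A * η)) ^ k * (k.factorial : ℝ) ^ δ / m.descFactorial k)) := by
  obtain ⟨p, hpd, hp⟩ := exists_polynomial_near_of_hasDerivAt hab _ k m hkm
    (fun j => iteratedDeriv j u) (fun j x hx => hu.hasDerivAt_iteratedDeriv hV j (hVI hx)) hbd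
  simp only [iteratedDeriv_zero] at hp
  refine abs_sub_eval_interpolate_le hinj hmem hstab u p hpd (fun x hx => (hp x hx).trans ?_) ht
  have hba : 0 < b - a := sub_pos.2 hab
  calc _ ≤ M₀ * ((A / D) ^ k * (k.factorial : ℝ) ^ δ) * (2 * (2 * η * D)) ^ k /
        m.descFactorial k := by gcongr
    _ = _ := by
      have : (4 * (A * η)) ^ k = (A / D) ^ k * (2 * (2 * η * D)) ^ k := by
        rw [← mul_pow]
        congr 1
        field_simp
        ring
      rw [this]
      ring

end Gevrey

section Tensor

variable {d m : ℕ}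

theorem coordInterpX_sub (v : Fin d → Fin (m + 1) → ℝ) (i : Fin d)
    (h₁ h₂ : (Fin d → ℝ) → (Fin d → ℝ) → ℝ) :
    coordInterpX v i (h₁ - h₂) = coordInterpX v i h₁ - coordInterpX v i h₂ := by
  funext x y
  simp only [coordInterpX, Pi.sub_apply]
  rw [← Polynomial.eval_sub, ← map_sub]
  rfl

theorem coordInterpY_sub (v : Fin d → Fin (m + 1) → ℝ) (i : Fin d)
    (h₁ h₂ : (Fin d → ℝ) → (Fin d → ℝ) → ℝ) :
    coordInterpY v i (h₁ - h₂) = coordInterpY v i h₁ - coordInterpY v i h₂ := by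
  funext x y
  simp only [coordInterpY, Pi.sub_apply]
  rw [← Polynomial.eval_sub, ← map_sub]
  rfl

/-- Tensor-product interpolation error in terms of an arbitrary order of differentiation. -/
theorem abs_sub_tensorInterpXY_le (hd : 1 ≤ d) {η δ CG A q Λ : ℝ} (hη : 0 < η) (hCG : 0 < CG)
    (hA : 0 < A) (hΛ : 1 ≤ Λ) {a b a' b' : Fin d → ℝ}
    (hab : ∀ i, a i < b i) (hab' : ∀ i, a' i < b' i)
    (hD : 0 < setDist2 (box a b) (box a' b'))
    (hadm : max (diamInf a b) (diamInf a' b') ≤ 2 * η * setDist2 (box a b) (box a' b'))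
    {v v' : Fin d → Fin (m + 1) → ℝ}
    (hinj : ∀ i, Function.Injective (v i)) (hinj' : ∀ i, Function.Injective (v' i))
    (hmem : ∀ i j, v i j ∈ Set.Icc (a i) (b i)) (hmem' : ∀ i j, v' i j ∈ Set.Icc (a' i) (b' i))
    (hstab : ∀ i, ∀ (w : Fin (m + 1) → ℝ) (M : ℝ), (∀ j, |w j| ≤ M) →
      ∀ y ∈ Set.Icc (a i) (b i), |(Lagrange.interpolate Finset.univ (v i) w).eval y| ≤ Λ * M)
    (hstab' : ∀ i, ∀ (w : Fin (m + 1) → ℝ) (M : ℝ), (∀ j, |w j| ≤ M) →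
      ∀ y ∈ Set.Icc (a' i) (b' i), |(Lagrange.interpolate Finset.univ (v' i) w).eval y| ≤ Λ * M)
    {g : (Fin d → ℝ) → (Fin d → ℝ) → ℝ}
    (hg : GevreyAsympSmooth δ CG A q (box a b) (box a' b') g) {k : ℕ} (hkm : k ≤ m)
    {x y : Fin d → ℝ} (hx : x ∈ box a b) (hy : y ∈ box a' b') :
    |g x y - tensorInterpXY v v' g x y| ≤ ((d + d : ℕ) : ℝ) * Λ ^ (d + d) * ((1 + Λ) *
      (CG * (d * (4 * η + 2)) ^ |-(2 * q + d)| * setDist2 (box a b) (box a' b') ^ (-(2 * q + d)) *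
        ((4 * (A * η)) ^ k * (k.factorial : ℝ) ^ δ / m.descFactorial k))) := by
  set D := setDist2 (box a b) (box a' b') with hDdef
  have hd' : (1 : ℝ) ≤ d := by exact_mod_cast hd
  have hc : (1 : ℝ) ≤ d * (4 * η + 2) := by nlinarith
  have hne : ∀ x ∈ box a b, ∀ y ∈ box a' b', x ≠ y := by
    rintro x hx y hy rfl
    have := setDist2_le_euclDist hx hy
    have h0 : euclDist x x = 0 := by simp [euclDist]
    linarith
  obtain ⟨U, hUo, hUsub, hUg⟩ := hg.1
  have hbound : ∀ x ∈ box a b, ∀ y ∈ box a' b', ∀ i, _ := fun x hx y hy i =>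
    hg.abs_pderiv_le hCG hA hD hc hx hy (hne x hx y hy) (setDist2_le_euclDist hx hy)
      (euclDist_le_of_admissible hd hη hD hadm hx hy) i k
  set M₀ := CG * (d * (4 * η + 2)) ^ |-(2 * q + d)| * D ^ (-(2 * q + d)) with hM₀
  have hM₀pos : 0 ≤ M₀ := by positivity
  have htotal := abs_sub_foldr_comp_le (box a b) (box a' b') g hΛ
    (E := (1 + Λ) * (M₀ * ((4 * (A * η)) ^ k * (k.factorial : ℝ) ^ δ / m.descFactorial k)))
    (by positivity)
    ((List.ofFn fun i : Fin d => coordInterpX v i) ++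
      (List.ofFn fun i : Fin d => coordInterpY v' i)) ?_ ?_ ?_ x hx y hy
  · simpa only [tensorInterpXY, List.length_append, List.length_ofFn] using htotal
  · intro T hT h₁ h₂
    simp only [List.mem_append, List.mem_ofFn] at hT
    obtain ⟨i, rfl⟩ | ⟨i, rfl⟩ := hT
    · exact coordInterpX_sub v i h₁ h₂
    · exact coordInterpY_sub v' i h₁ h₂
  · intro T hT h M hM x hx y hy
    simp only [List.mem_append, List.mem_ofFn] at hT
    obtain ⟨i, rfl⟩ | ⟨i, rfl⟩ := hT
    · exact hstab i _ M (fun j => hM _ (update_mem_box hx i (hmem i j)) _ hy) _ (hx i)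
    · exact hstab' i _ M (fun j => hM _ hx _ (update_mem_box hy i (hmem' i j))) _ (hy i)
  · intro T hT x hx y hy
    simp only [List.mem_append, List.mem_ofFn] at hT
    obtain ⟨i, rfl⟩ | ⟨i, rfl⟩ := hT
    · have hsmooth : ContDiff ℝ (⊤ : ℕ∞) fun t : ℝ => (Function.update x i t, y) :=
        (contDiff_update _ x i).prodMk contDiff_const
      have h := abs_sub_eval_interpolate_le_of_gevrey (δ := δ) (hab i) hkm hD hη hA hM₀pos
        ((sub_le_diamInf a b i).trans ((le_max_left _ _).trans hadm)) (hinj i) (hmem i) (hstab i)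
        (u := fun t => g (Function.update x i t) y) (hUo.preimage hsmooth.continuous)
        (fun t ht => hUsub ⟨update_mem_box hx i ht, hy, hne _ (update_mem_box hx i ht) _ hy⟩)
        (hUg.comp hsmooth.contDiffOn fun t ht => ht)
        (fun t ht => by
          have := (hbound _ (update_mem_box hx i ht) y hy i).1
          rw [pderivX_iterate] at this
          simpa using this) (hx i)
      simpa [coordInterpX] using h
    · have hsmooth : ContDiff ℝ (⊤ : ℕ∞) fun t : ℝ => (x, Function.update y i t) :=
        contDiff_const.prodMk (contDiff_update _ y i)
      have h := abs_sub_eval_interpolate_le_of_gevrey (δ := δ) (hab' i) hkm hD hη hA hM₀pos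
        ((sub_le_diamInf a' b' i).trans ((le_max_right _ _).trans hadm)) (hinj' i) (hmem' i)
        (hstab' i)
        (u := fun t => g x (Function.update y i t)) (hUo.preimage hsmooth.continuous)
        (fun t ht => hUsub ⟨hx, update_mem_box hy i ht, hne _ hx _ (update_mem_box hy i ht)⟩)
        (hUg.comp hsmooth.contDiffOn fun t ht => ht)
        (fun t ht => by
          have := (hbound x hx _ (update_mem_box hy i ht) i).2
          rw [pderivY_iterate] at this
          simpa using this) (hy i)
      simpa [coordInterpY] using h

end Tensor

/-- Fix `d ≥ 1`, `η > 0`, `δ ≥ 1`, `C_G, A > 0`, `q ∈ ℝ`, `C_Λ, λ ≥ 1`, and for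
each integer `m ≥ 3` and each coordinate interval `[a,b]` a choice
`nodes a b m` of `m+1` distinct nodes in `[a,b]` whose univariate Lagrange
interpolation is sup-norm stable with constant `Λ_m ≥ 1`, `Λ_m ≤ C_Λ(m+1)^λ`.
Set `ρ̃ = min{Aη/(Aη+1), Aη/2}^{1/e²}`.  Then there is `C_in > 0` such that for
all `η`-admissible boxes `Q_t, Q_s` with `dist_2(Q_t,Q_s) > 0`, all `g` that are
`G^δ(C_G,A)`-asymptotically smooth with exponent `q` on `Q_t × Q_s`, and all
`m ≥ 3`, the tensor-product interpolant `g̃ = 𝓘_m^{Q_t×Q_s}[g]` satisfies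
`‖g - g̃‖_{C(Q_t×Q_s)} ≤ C_in · dist_2(Q_t,Q_s)^{-(2q+d)} · ρ̃^{m^{1/δ}}`. -/
theorem stmt4 (d : ℕ) (hd : 1 ≤ d) (η δ CG A q CΛ lam : ℝ)
    (hη : 0 < η) (hδ : 1 ≤ δ) (hCG : 0 < CG) (hA : 0 < A)
    (hCΛ : 1 ≤ CΛ) (hlam : 1 ≤ lam)
    (nodes : ℝ → ℝ → (m : ℕ) → Fin (m + 1) → ℝ) (Λ : ℕ → ℝ)
    (hΛ1 : ∀ m : ℕ, 3 ≤ m → 1 ≤ Λ m)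
    (hΛgrowth : ∀ m : ℕ, 3 ≤ m → Λ m ≤ CΛ * ((m : ℝ) + 1) ^ lam)
    (hinj : ∀ a b : ℝ, a < b → ∀ m : ℕ, 3 ≤ m →
      Function.Injective (nodes a b m))
    (hmem : ∀ a b : ℝ, a < b → ∀ m : ℕ, 3 ≤ m →
      ∀ j, nodes a b m j ∈ Set.Icc a b)
    (hstab : ∀ a b : ℝ, a < b → ∀ m : ℕ, 3 ≤ m →
      ∀ u : ℝ → ℝ, ContinuousOn u (Set.Icc a b) →
        ∀ M : ℝ, (∀ x ∈ Set.Icc a b, |u x| ≤ M) →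
          ∀ y ∈ Set.Icc a b,
            |(Lagrange.interpolate Finset.univ (nodes a b m)
              (fun j => u (nodes a b m j))).eval y| ≤ Λ m * M) :
    ∃ Cin : ℝ, 0 < Cin ∧
      ∀ at_ bt as_ bs : Fin d → ℝ,
        (∀ i, at_ i < bt i) → (∀ i, as_ i < bs i) →
        0 < setDist2 (box at_ bt) (box as_ bs) →
        max (diamInf at_ bt) (diamInf as_ bs) ≤
          2 * η * setDist2 (box at_ bt) (box as_ bs) →
        ∀ g : (Fin d → ℝ) → (Fin d → ℝ) → ℝ,
          GevreyAsympSmooth δ CG A q (box at_ bt) (box as_ bs) g →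
          ∀ m : ℕ, 3 ≤ m →
            ∀ x ∈ box at_ bt, ∀ y ∈ box as_ bs,
              |g x y - tensorInterpXY (fun i => nodes (at_ i) (bt i) m)
                  (fun i => nodes (as_ i) (bs i) m) g x y| ≤
                Cin * setDist2 (box at_ bt) (box as_ bs) ^ (-(2 * q + d)) *
                  (min (A * η / (A * η + 1)) (A * η / 2) ^
                    (1 / Real.exp 2)) ^ ((m : ℝ) ^ (1 / δ)) := by
  have hδ0 : 0 < δ := by linarith
  have hs : 0 < A * η := mul_pos hA hη
  have hd' : (1 : ℝ) ≤ d := by exact_mod_cast hd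
  set ρ : ℝ := min (A * η / (A * η + 1)) (A * η / 2) ^ (1 / Real.exp 2) with hρ
  set r : ℝ := 4 * (A * η) / (1 + 4 * (A * η)) with hr
  have hrρ : r < ρ := min_rate_lt hs
  have hr0 : 0 < r := by positivity
  have hr1 : r ≤ 1 := by rw [hr, div_le_one (by positivity)]; linarith
  have hρ0 : 0 < ρ := hr0.trans hrρ
  obtain ⟨K, hK0, hK⟩ := exists_forall_rpow_mul_stretched_le (δ := δ)
    (μ := lam * ((d + d + 1 : ℕ) : ℝ) + δ) (θ := r / ρ) hδ (by positivity)
    (div_pos hr0 hρ0) ((div_lt_one hρ0).2 hrρ)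
  set C₁ : ℝ := (d * (4 * η + 2)) ^ |-(2 * q + d)| with hC₁
  have hC₁pos : 0 < C₁ := by positivity
  refine ⟨((d + d : ℕ) : ℝ) * 2 * CΛ ^ (d + d + 1) * CG * C₁ * r⁻¹ * K, ?_, ?_⟩
  · have : (0 : ℝ) < (d + d : ℕ) := by push_cast; linarith
    positivity
  intro at_ bt as_ bs hab hab' hD hadm g hg m hm x hx y hy
  set D := setDist2 (box at_ bt) (box as_ bs) with hDdef
  have hm1 : (1 : ℝ) ≤ m := by exact_mod_cast (by omega : 1 ≤ m)
  set N : ℕ := ⌊(m : ℝ) ^ (1 / δ)⌋₊ with hN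
  have hNle : (N : ℝ) ≤ (m : ℝ) ^ (1 / δ) := Nat.floor_le (by positivity)
  have hNδ : (N : ℝ) ^ δ ≤ m := by
    calc _ ≤ ((m : ℝ) ^ (1 / δ)) ^ δ := by gcongr
      _ = m := by rw [← Real.rpow_mul (by positivity), one_div_mul_cancel hδ0.ne', Real.rpow_one]
  have hNm' : (N : ℝ) ≤ m := hNle.trans (by
    calc _ ≤ (m : ℝ) ^ (1 : ℝ) := Real.rpow_le_rpow_of_exponent_le hm1
          ((div_le_one hδ0).2 hδ)
      _ = m := Real.rpow_one _)
  have hNm : N ≤ m := by exact_mod_cast hNm'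
  obtain ⟨k, hkN, hk⟩ := exists_factorial_rate_le (B := 4 * (A * η)) hδ (by positivity) hNδ
  have hΛ := hΛ1 m hm
  have hmain := abs_sub_tensorInterpXY_le hd hη hCG hA hΛ hab hab' hD hadm
    (fun i => hinj _ _ (hab i) m hm) (fun i => hinj _ _ (hab' i) m hm)
    (fun i => hmem _ _ (hab i) m hm) (fun i => hmem _ _ (hab' i) m hm)
    (fun i w M hw y hy => abs_eval_interpolate_le (hinj _ _ (hab i) m hm)
      (hstab _ _ (hab i) m hm) w M hw hy)
    (fun i w M hw y hy => abs_eval_interpolate_le (hinj _ _ (hab' i) m hm)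
      (hstab _ _ (hab' i) m hm) w M hw hy) hg (hkN.trans hNm) hx hy
  refine hmain.trans ?_
  have hDp : 0 < D ^ (-(2 * q + d)) := by positivity
  have hrN : r ^ N ≤ r⁻¹ * r ^ ((m : ℝ) ^ (1 / δ)) := by
    have h1 : (m : ℝ) ^ (1 / δ) - 1 ≤ N := by linarith [Nat.lt_floor_add_one ((m : ℝ) ^ (1 / δ))]
    calc r ^ N = r ^ (N : ℝ) := (Real.rpow_natCast _ _).symm
      _ ≤ r ^ ((m : ℝ) ^ (1 / δ) - 1) := Real.rpow_le_rpow_of_exponent_ge hr0 hr1 h1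
      _ = _ := by rw [Real.rpow_sub_one hr0.ne', div_eq_inv_mul]
  have hΛpow : Λ m ^ (d + d + 1) ≤
      CΛ ^ (d + d + 1) * ((m : ℝ) + 1) ^ (lam * ((d + d + 1 : ℕ) : ℝ)) := by
    calc _ ≤ (CΛ * ((m : ℝ) + 1) ^ lam) ^ (d + d + 1) := by
          gcongr
          exact hΛgrowth m hm
      _ = _ := by rw [mul_pow, Real.rpow_mul (by positivity), Real.rpow_natCast]
  have hKm := hK m (by omega)
  rw [Real.rpow_add (by positivity), Real.div_rpow hr0.le hρ0.le, mul_div_assoc',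
    div_le_iff₀ (by positivity)] at hKm
  set X : ℝ := (m : ℝ) ^ (1 / δ) with hX
  calc _ ≤ ((d + d : ℕ) : ℝ) * Λ m ^ (d + d) * ((Λ m + Λ m) *
        (CG * C₁ * D ^ (-(2 * q + d)) * (((m : ℝ) + 1) ^ δ * (r⁻¹ * r ^ X)))) := by
        have h3 : (4 * (A * η)) ^ k * (k.factorial : ℝ) ^ δ / m.descFactorial k ≤
            ((m : ℝ) + 1) ^ δ * (r⁻¹ * r ^ X) := hk.trans (by gcongr)
        gcongr
    _ = ((d + d : ℕ) : ℝ) * 2 * CG * C₁ * r⁻¹ * D ^ (-(2 * q + d)) *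
        (Λ m ^ (d + d + 1) * (((m : ℝ) + 1) ^ δ * r ^ X)) := by ring
    _ ≤ ((d + d : ℕ) : ℝ) * 2 * CG * C₁ * r⁻¹ * D ^ (-(2 * q + d)) *
        (CΛ ^ (d + d + 1) * ((m : ℝ) + 1) ^ (lam * ((d + d + 1 : ℕ) : ℝ)) *
          (((m : ℝ) + 1) ^ δ * r ^ X)) := by gcongr
    _ = ((d + d : ℕ) : ℝ) * 2 * CG * C₁ * r⁻¹ * D ^ (-(2 * q + d)) * CΛ ^ (d + d + 1) *
        (((m : ℝ) + 1) ^ (lam * ((d + d + 1 : ℕ) : ℝ)) * ((m : ℝ) + 1) ^ δ * r ^ X) := by ring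
    _ ≤ ((d + d : ℕ) : ℝ) * 2 * CG * C₁ * r⁻¹ * D ^ (-(2 * q + d)) * CΛ ^ (d + d + 1) *
        (K * ρ ^ X) := by gcongr
    _ = _ := by ring
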